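/- Let G be a finite group, N ≤ Z(G) a central π-subgroup, and let θ, μ be (necessarily linear) G-invariant irreducible characters of N. Suppose χ ∈ Irr(G) lies over μ and has relative π-defect zero over μ, i.e., (χ(1)/μ(1))_π = |G/N|_π. Define ψ on G by ψ(g) = θ(g_π)χ(g_{π'}) if g_π ∈ N and ψ(g) = 0 otherwise. Then ψ is an irreducible character of G lying over θ with relative π-defect zero over θ, and the map χ ↦ ψ is a bijection from rdz_π(G|μ) onto rdz_π(G|θ). -/

import Mathlib

open scoped BigOperators
noncomputable section

open Classical in
/-- The `π`-part of a natural number: the product of prime powers in its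
factorization whose primes lie in `π`. -/
def Nat.piPart (π : Set ℕ) (n : ℕ) : ℕ :=
  n.factorization.prod fun p k => if p ∈ π then p ^ k else 1

/-- `n` is a `π`-number if every prime dividing `n` lies in `π`. -/
def IsPiNumber (π : Set ℕ) (n : ℕ) : Prop :=
  ∀ p : ℕ, p.Prime → p ∣ n → p ∈ π

/-- The `π`-part of an element of a finite group: the unique power of `g`
whose order is a `π`-number and whose complementary part has `π'`-order. -/
def elemPiPart (π : Set ℕ) {G : Type} [Group G] (g : G) : G :=
  g ^ ((orderOf g / Nat.piPart π (orderOf g)) ^ Nat.totient (Nat.piPart π (orderOf g)))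

/-- `χ` is the character of some finite-dimensional complex representation of `G`. -/
def IsChar (G : Type) [Group G] (χ : G → ℂ) : Prop :=
  ∃ V : FDRep ℂ G, ∀ g : G, χ g = V.character g

/-- The usual inner product of complex class functions. -/
def charInner (G : Type) [Group G] (φ ψ : G → ℂ) : ℂ :=
  (Nat.card G : ℂ)⁻¹ * ∑ᶠ g : G, φ g * starRingEnd ℂ (ψ g)

/-- An irreducible character: a character of norm one. -/
def IsIrrChar (G : Type) [Group G] (χ : G → ℂ) : Prop :=
  IsChar G χ ∧ charInner G χ χ = 1

/-- A class function. -/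
def IsClassFun (G : Type) [Group G] (φ : G → ℂ) : Prop :=
  ∀ g h : G, φ (h * g * h⁻¹) = φ g

/-- A virtual (generalized) character: a difference of two characters. -/
def IsGenChar (G : Type) [Group G] (ψ : G → ℂ) : Prop :=
  ∃ α β : G → ℂ, IsChar G α ∧ IsChar G β ∧ ψ = α - β

/-- `θ`, a character of the normal subgroup `N` of `G`, is `G`-invariant. -/
def IsGInvariant {G : Type} [Group G] (N : Subgroup G) [hN : N.Normal]
    (θ : ↥N → ℂ) : Prop :=
  ∀ (g : G) (n : ↥N), θ ⟨g * (n : G) * g⁻¹, hN.conj_mem (n : G) n.2 g⟩ = θ n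

/-- π-defect zero irreducible characters of a group `Q`. -/
def dzSet (π : Set ℕ) (Q : Type) [Group Q] : Set (Q → ℂ) :=
  {χ | IsIrrChar Q χ ∧ ∃ d : ℕ, χ 1 = (d : ℂ) ∧
    Nat.piPart π d = Nat.piPart π (Nat.card Q)}

/-- Irreducible characters of `G` lying over `θ ∈ Irr N` of relative π-defect zero. -/
def rdzSet (π : Set ℕ) (G : Type) [Group G] (N : Subgroup G) (θ : ↥N → ℂ) :
    Set (G → ℂ) :=
  {χ | IsIrrChar G χ ∧ charInner ↥N (fun n : ↥N => χ (n : G)) θ ≠ 0 ∧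
    ∃ m : ℕ, χ 1 = θ 1 * (m : ℂ) ∧ Nat.piPart π m = Nat.piPart π N.index}

section Representations

variable {H V : Type*} [Group H] [AddCommGroup V] [Module ℂ V] [FiniteDimensional ℂ V]

theorem exists_trace_pow_eq_sum {T : Module.End ℂ V} {n : ℕ} (hn : 0 < n) (hT : T ^ n = 1) :
    ∃ (s : Finset ℂ) (d : ℂ → ℕ), (∀ z ∈ s, z ^ n = 1) ∧
      ∀ k : ℕ, LinearMap.trace ℂ V (T ^ k) = ∑ z ∈ s, (d z : ℂ) * z ^ k := by
  classical
  have hss : T.IsSemisimple := by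
    refine Module.End.isSemisimple_of_squarefree_aeval_eq_zero
      (p := (Polynomial.X ^ n - 1 : Polynomial ℂ)) ?_ (by simp [hT])
    exact (Polynomial.separable_X_pow_sub_C (1 : ℂ) (by exact_mod_cast hn.ne')
      one_ne_zero).squarefree
  have hds := DirectSum.isInternal_submodule_of_iSupIndep_of_iSup_eq_top
      T.eigenspaces_iSupIndep hss.iSup_eigenspace_eq_top
  have hfin : {μ | T.eigenspace μ ≠ ⊥}.Finite :=
    WellFoundedGT.finite_ne_bot_of_iSupIndep T.eigenspaces_iSupIndep
  refine ⟨hfin.toFinset, fun μ => Module.finrank ℂ (T.eigenspace μ), ?_, fun k => ?_⟩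
  · intro z hz
    obtain ⟨v, hv, hv0⟩ := (Submodule.ne_bot_iff _).1 (hfin.mem_toFinset.1 hz)
    have h := Module.End.HasEigenvector.pow_apply (f := T) (μ := z) ⟨hv, hv0⟩ n
    rw [hT, Module.End.one_apply] at h
    exact (smul_left_injective ℂ hv0 (by simpa using h)).symm
  · have hv : ∀ μ : ℂ, ∀ v ∈ T.eigenspace μ, (T ^ k) v = μ ^ k • v := fun μ v hv => by
      by_cases h0 : v = 0
      · simp [h0]
      · exact Module.End.HasEigenvector.pow_apply ⟨hv, h0⟩ k
    have hm : ∀ μ, Set.MapsTo (T ^ k) (T.eigenspace μ) (T.eigenspace μ) := fun μ v h => by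
      rw [hv μ v h]; exact Submodule.smul_mem _ _ h
    rw [LinearMap.trace_eq_sum_trace_restrict' hds hfin hm]
    refine Finset.sum_congr rfl fun μ _ => ?_
    have : (T ^ k).restrict (hm μ) = (μ ^ k) • LinearMap.id := by
      ext v; exact hv μ v v.2
    rw [this, map_smul, LinearMap.trace_id, smul_eq_mul, mul_comm]

theorem isIntegral_of_pow_eq_one {z : ℂ} {n : ℕ} (hn : 0 < n) (hz : z ^ n = 1) : IsIntegral ℤ z :=
  IsIntegral.of_pow hn (hz ▸ isIntegral_one)

theorem isIntegral_trace_of_pow_eq_one {T : Module.End ℂ V} {n : ℕ} (hn : 0 < n) (hT : T ^ n = 1) :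
    IsIntegral ℤ (LinearMap.trace ℂ V T) := by
  obtain ⟨s, d, hs, h⟩ := exists_trace_pow_eq_sum hn hT
  rw [← pow_one T, h]
  exact IsIntegral.sum _ fun z hz =>
    (isIntegral_algebraMap (R := ℤ) (x := (d z : ℤ))).mul
      ((isIntegral_of_pow_eq_one hn (hs z hz)).pow 1)

omit [FiniteDimensional ℂ V] in
theorem rep_pow_card [Finite H] (ρ : Representation ℂ H V) (g : H) : ρ g ^ Nat.card H = 1 := by
  rw [← map_pow, pow_card_eq_one', map_one]

theorem isIntegral_character [Finite H] (ρ : Representation ℂ H V) (g : H) :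
    IsIntegral ℤ (ρ.character g) :=
  isIntegral_trace_of_pow_eq_one Nat.card_pos (rep_pow_card ρ g)

theorem conj_character [Finite H] (ρ : Representation ℂ H V) (g : H) :
    starRingEnd ℂ (ρ.character g) = ρ.character g⁻¹ := by
  obtain ⟨s, d, hs, h⟩ := exists_trace_pow_eq_sum Nat.card_pos (rep_pow_card ρ g)
  have h1 : ρ.character g = LinearMap.trace ℂ V (ρ g ^ 1) := by
    rw [pow_one]; rfl
  have h2 : ρ.character g⁻¹ = LinearMap.trace ℂ V (ρ g ^ (Nat.card H - 1)) := by
    rw [← map_pow, Representation.character]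
    congr 2
    exact (eq_inv_of_mul_eq_one_left
      (by rw [← pow_succ, Nat.sub_add_cancel Nat.card_pos, pow_card_eq_one'])).symm
  rw [h1, h2, h, h, map_sum]
  refine Finset.sum_congr rfl fun z hz => ?_
  have hz1 := hs z hz
  have hn : ‖z‖ = 1 := Complex.norm_eq_one_of_pow_eq_one hz1 Nat.card_pos.ne'
  rw [map_mul, map_natCast, pow_one, ← Complex.inv_eq_conj hn]
  congr 1
  exact inv_eq_of_mul_eq_one_left
    (by rw [← pow_succ, Nat.sub_add_cancel Nat.card_pos, hz1])

/-- The trace of `A` is an algebraic integer if `A` satisfies `A ^ (n + 1) = A`. -/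
theorem isIntegral_trace_of_pow_succ_eq {A : Module.End ℂ V} {n : ℕ} (hn : 0 < n)
    (hA : A ^ (n + 1) = A) : IsIntegral ℤ (LinearMap.trace ℂ V A) := by
  let b := Module.finBasis ℂ V
  rw [LinearMap.trace_eq_matrix_trace ℂ b, Matrix.trace_eq_sum_roots_charpoly,
    LinearMap.charpoly_toMatrix]
  refine IsIntegral.multiset_sum fun z hz => ?_
  have hr := Polynomial.isRoot_of_mem_roots hz
  rw [← Module.End.hasEigenvalue_iff_isRoot_charpoly] at hr
  obtain ⟨v, hv⟩ := hr.exists_hasEigenvector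
  have h := hv.pow_apply (n + 1)
  rw [hA, hv.apply_eq_smul] at h
  have h1 : z = z ^ (n + 1) := smul_left_injective ℂ hv.2 h
  by_cases h0 : z = 0
  · rw [h0]; exact isIntegral_zero
  · exact isIntegral_of_pow_eq_one hn (mul_right_cancel₀ h0 (by rw [← pow_succ, ← h1, one_mul]))

theorem isIntegral_average_trace [Fintype H] (ρ : Representation ℂ H V) {T : Module.End ℂ V}
    (hc : ∀ x, Commute (ρ x) T) {n : ℕ} (hn : 0 < n) (hT : T ^ n = 1) :
    IsIntegral ℤ ((Nat.card H : ℂ)⁻¹ * ∑ x : H, LinearMap.trace ℂ V (ρ x * T)) := by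
  have hH : (Nat.card H : ℂ) ≠ 0 := by exact_mod_cast Nat.card_pos.ne'
  set e : Module.End ℂ V := (Nat.card H : ℂ)⁻¹ • ∑ x : H, ρ x with he
  have hx : ∀ x, ρ x * e = e := fun x => by
    rw [he, mul_smul_comm, Finset.mul_sum]
    congr 1
    exact Fintype.sum_equiv (Equiv.mulLeft x) _ _ fun y => by simp
  have hee : e * e = e := by
    conv_lhs => enter [1]; rw [he]
    rw [smul_mul_assoc, Finset.sum_mul, Finset.sum_congr rfl fun x _ => hx x, Finset.sum_const,
      Finset.card_univ, ← Nat.card_eq_fintype_card, ← Nat.cast_smul_eq_nsmul ℂ, smul_smul,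
      inv_mul_cancel₀ hH, one_smul]
  have heT : Commute e T := by
    rw [he]
    exact (Commute.sum_left _ _ _ fun x _ => hc x).smul_left _
  have hpow : (e * T) ^ (n + 1) = e * T := by
    rw [heT.mul_pow, pow_succ T, hT, one_mul, IsIdempotentElem.pow_succ_eq n hee]
  convert isIntegral_trace_of_pow_succ_eq hn hpow using 1
  rw [he, smul_mul_assoc, map_smul, Finset.sum_mul, map_sum, smul_eq_mul]

/-- The permutation representation on the functions on a finite `H`-set. -/
def permutationRep (H X : Type*) [Group H] [MulAction H X] : Representation ℂ H (X → ℂ) where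
  toFun x := LinearMap.funLeft ℂ ℂ (x⁻¹ • ·)
  map_one' := by ext; simp [LinearMap.funLeft_apply]
  map_mul' x y := by ext; simp [LinearMap.funLeft_apply, mul_smul]

theorem character_permutationRep {X : Type*} [MulAction H X] [Fintype X] (x : H) :
    (permutationRep H X).character x = (Nat.card (MulAction.fixedBy X x) : ℂ) := by
  classical
  rw [Representation.character, LinearMap.trace_eq_matrix_trace ℂ (Pi.basisFun ℂ X), Matrix.trace]
  have : ∀ i : X, (LinearMap.toMatrix (Pi.basisFun ℂ X) (Pi.basisFun ℂ X)
      (permutationRep H X x)).diag i = if x • i = i then 1 else 0 := fun i => by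
    simp [permutationRep, LinearMap.funLeft_apply, Pi.single_apply, inv_smul_eq_iff,
      eq_comm (a := i)]
  rw [Finset.sum_congr rfl fun i _ => this i, Finset.sum_boole, Nat.card_eq_fintype_card,
    Fintype.card_subtype]
  rfl

end Representations
section Irreducible

variable {G V : Type*} [Group G] [Fintype G] [AddCommGroup V] [Module ℂ V] [FiniteDimensional ℂ V]

/-- Schur's lemma for a representation whose character has norm one. -/
theorem exists_smul_of_commute (ρ : Representation ℂ G V)
    (hρ : (Nat.card G : ℂ)⁻¹ * ∑ g : G, ρ.character g * ρ.character g⁻¹ = 1)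
    {T : Module.End ℂ V} (hT : ∀ x, Commute (ρ x) T) : ∃ c : ℂ, T = c • 1 := by
  have : Invertible (Nat.card G : ℂ) :=
    invertibleOfNonzero (by exact_mod_cast Nat.card_pos.ne')
  rw [Representation.card_inv_mul_sum_char_mul_char_eq_finrank] at hρ
  have h1 : Module.finrank ℂ (Representation.IntertwiningMap ρ ρ) = 1 := by exact_mod_cast hρ
  have h0 : Representation.IntertwiningMap.id ρ ≠ 0 := fun h => by
    have hz : ∀ f : Representation.IntertwiningMap ρ ρ, f = 0 := fun f => by
      ext v
      have : Representation.IntertwiningMap.id ρ v = 0 := by rw [h]; rfl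
      rw [Representation.IntertwiningMap.id_apply] at this
      simp [this]
    have : Subsingleton (Representation.IntertwiningMap ρ ρ) :=
      ⟨fun f f' => by rw [hz f, hz f']⟩
    rw [Module.finrank_zero_of_subsingleton] at h1
    exact zero_ne_one h1
  obtain ⟨c, hc⟩ := (finrank_eq_one_iff_of_nonzero' _ h0).1 h1
    (T.intertwiningMap_of_isIntertwiningMap ρ ρ fun g v => (LinearMap.congr_fun (hT g) v).symm)
  refine ⟨c, ?_⟩
  have := congrArg Representation.IntertwiningMap.toLinearMap hc
  exact this.symm

theorem isIntegral_card_mul_character_div (ρ : Representation ℂ G V)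
    (hρ : (Nat.card G : ℂ)⁻¹ * ∑ g : G, ρ.character g * ρ.character g⁻¹ = 1) (y : G) :
    IsIntegral ℤ ((ρ.character 1)⁻¹ * (Nat.card {x // IsConj y x} * ρ.character y)) := by
  classical
  set z : MonoidAlgebra ℤ G := ∑ x ∈ Finset.univ.filter (IsConj y), MonoidAlgebra.of ℤ G x with hz
  set F : MonoidAlgebra ℤ G →ₐ[ℤ] Module.End ℂ V := MonoidAlgebra.lift ℤ _ G ρ with hF
  have hFz : F z = ∑ x ∈ Finset.univ.filter (IsConj y), ρ x := by
    rw [hz, map_sum]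
    exact Finset.sum_congr rfl fun x _ => by rw [hF, MonoidAlgebra.lift_of]
  have hcomm : ∀ x, Commute (ρ x) (F z) := fun x => by
    rw [hFz, commute_iff_eq, Finset.mul_sum, Finset.sum_mul]
    refine Finset.sum_nbij' (fun w => x * w * x⁻¹) (fun w => x⁻¹ * w * x) ?_ ?_ ?_ ?_ ?_
    · intro w hw
      simp only [Finset.mem_filter, Finset.mem_univ, true_and] at hw ⊢
      exact hw.trans (isConj_iff.2 ⟨x, rfl⟩)
    · intro w hw
      simp only [Finset.mem_filter, Finset.mem_univ, true_and] at hw ⊢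
      exact hw.trans (isConj_iff.2 ⟨x⁻¹, by simp⟩)
    · intro w _; group
    · intro w _; group
    · intro w _; simp [← map_mul]
  obtain ⟨c, hc⟩ := exists_smul_of_commute ρ hρ hcomm
  have htr : (Nat.card {x // IsConj y x} : ℂ) * ρ.character y = c * ρ.character 1 := by
    have h := congrArg (LinearMap.trace ℂ V) (hFz.symm.trans hc)
    rw [map_sum, map_smul, smul_eq_mul] at h
    rw [← (ρ.map_one : ρ 1 = 1)] at h
    rw [Representation.character, Representation.character, ← h, Nat.card_eq_fintype_card,
      Fintype.card_subtype, Finset.sum_congr rfl (g := fun _ => LinearMap.trace ℂ V (ρ y)),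
      Finset.sum_const, nsmul_eq_mul]
    intro x hx
    obtain ⟨a, rfl⟩ := isConj_iff.1 (Finset.mem_filter.1 hx).2
    exact ρ.char_conj y a
  have hInt : IsIntegral ℤ (F z) := (IsIntegral.of_finite ℤ z).map F
  rw [htr]
  by_cases h1 : ρ.character 1 = 0
  · rw [h1, inv_zero, zero_mul]; exact isIntegral_zero
  rw [mul_comm c, inv_mul_cancel_left₀ h1]
  have hV : Nontrivial V := by
    rw [ρ.char_one] at h1
    exact Module.nontrivial_of_finrank_pos (R := ℂ) (Nat.pos_of_ne_zero (by exact_mod_cast h1))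
  rw [hc, ← Algebra.algebraMap_eq_smul_one] at hInt
  exact (isIntegral_algebraMap_iff (FaithfulSMul.algebraMap_injective ℂ (Module.End ℂ V))).1 hInt

omit [Fintype G] in
theorem character_eq_add_of_isCompl (ρ : Representation ℂ G V) {p q : Subrepresentation ρ}
    (h : IsCompl p q) (g : G) :
    ρ.character g = p.toRepresentation.character g + q.toRepresentation.character g := by
  have hpq : IsCompl p.toSubmodule q.toSubmodule := by
    refine ⟨disjoint_iff.2 ?_, codisjoint_iff.2 ?_⟩
    · rw [← Subrepresentation.toSubmodule_inf, disjoint_iff.1 h.1]; rfl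
    · rw [← Subrepresentation.toSubmodule_sup, codisjoint_iff.1 h.2]; rfl
  let N : Bool → Submodule ℂ V := fun b => cond b p.toSubmodule q.toSubmodule
  have hN : DirectSum.IsInternal N :=
    (DirectSum.isInternal_submodule_iff_isCompl N (i := true) (j := false) (by decide)
      (by ext b; cases b <;> simp)).2 hpq
  have hm : ∀ b, Set.MapsTo (ρ g) (N b) (N b) := by
    rintro (_ | _)
    · exact q.apply_mem_toSubmodule g
    · exact p.apply_mem_toSubmodule g
  rw [Representation.character, LinearMap.trace_eq_sum_trace_restrict hN hm, Fintype.sum_bool]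
  rfl

theorem exists_irreducible_constituent (f : G → ℂ) (n : ℕ) :
    ∀ (V : Type) [AddCommGroup V] [Module ℂ V] [FiniteDimensional ℂ V] (ρ : Representation ℂ G V),
      Module.finrank ℂ V = n → ∑ g, f g * ρ.character g⁻¹ ≠ 0 →
      ∃ (W : Type) (_ : AddCommGroup W) (_ : Module ℂ W) (_ : FiniteDimensional ℂ W)
        (σ : Representation ℂ G W), ∑ g, f g * σ.character g⁻¹ ≠ 0 ∧
          (Nat.card G : ℂ)⁻¹ * ∑ g : G, σ.character g * σ.character g⁻¹ = 1 := by
  induction n using Nat.strong_induction_on with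
  | _ n ih =>
    intro V _ _ _ ρ hn hf
    have : Invertible (Nat.card G : ℂ) :=
      invertibleOfNonzero (by exact_mod_cast Nat.card_pos.ne')
    have : NeZero (Nat.card G : ℂ) := ⟨by exact_mod_cast Nat.card_pos.ne'⟩
    by_cases hirr : ρ.IsIrreducible
    · refine ⟨V, _, _, ‹_›, ρ, hf, ?_⟩
      rw [Representation.card_inv_mul_sum_char_mul_char_eq_finrank,
        Representation.IsIrreducible.finrank_intertwiningMap_self, Nat.cast_one]
    have hnt : Nontrivial (Subrepresentation ρ) := by
      refine ⟨⊥, ⊤, fun h => hf (Finset.sum_eq_zero fun g _ => ?_)⟩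
      have h' : (⊥ : Submodule ℂ V) = ⊤ := congrArg Subrepresentation.toSubmodule h
      have : Subsingleton V := (Submodule.subsingleton_iff ℂ).1 (subsingleton_of_bot_eq_top h')
      have : ρ g⁻¹ = 0 := Subsingleton.elim _ _
      rw [Representation.character, this, map_zero, mul_zero]
    obtain ⟨p, hp⟩ : ∃ p : Subrepresentation ρ, ¬ (p = ⊥ ∨ p = ⊤) := by
      by_contra! hall
      exact hirr ⟨hall⟩
    push Not at hp
    obtain ⟨q, hpq⟩ := exists_isCompl p
    have hlt : ∀ r : Subrepresentation ρ, r ≠ ⊤ → Module.finrank ℂ r.toSubmodule < n := by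
      intro r hr
      rw [← hn]
      exact Submodule.finrank_lt fun h => hr (Subrepresentation.toSubmodule_injective h)
    have hq : q ≠ ⊤ := fun h => hp.1 (eq_bot_of_isCompl_top (h ▸ hpq))
    by_cases h1 : ∑ g, f g * p.toRepresentation.character g⁻¹ = 0
    · refine ih _ (hlt q hq) _ q.toRepresentation rfl fun h2 => hf ?_
      rw [← add_zero (0 : ℂ)]
      nth_rw 1 [← h1]
      rw [← h2, ← Finset.sum_add_distrib]
      exact Finset.sum_congr rfl fun g _ => by rw [character_eq_add_of_isCompl ρ hpq, mul_add]
    · exact ih _ (hlt p hp.2) _ p.toRepresentation rfl h1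

theorem exists_irreducible_of_apply_one_ne_zero {G : Type} [Group G] [Fintype G] {f : G → ℂ}
    (hf : f 1 ≠ 0) :
    ∃ (W : Type) (_ : AddCommGroup W) (_ : Module ℂ W) (_ : FiniteDimensional ℂ W)
      (σ : Representation ℂ G W), ∑ g, f g * σ.character g⁻¹ ≠ 0 ∧
        (Nat.card G : ℂ)⁻¹ * ∑ g : G, σ.character g * σ.character g⁻¹ = 1 := by
  refine exists_irreducible_constituent f _ (G → ℂ) (permutationRep G G) rfl ?_
  rw [Finset.sum_eq_single (1 : G), inv_one, Representation.char_one]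
  · rw [Module.finrank_fintype_fun_eq_card]
    exact mul_ne_zero hf (by exact_mod_cast Fintype.card_ne_zero)
  · intro g _ hg
    rw [character_permutationRep]
    have : MulAction.fixedBy G g⁻¹ = ∅ := by
      ext x
      simpa [MulAction.mem_fixedBy] using hg
    rw [this]; simp
  · simp

end Irreducible
section PrimeElements

theorem IsPiNumber.of_dvd {σ : Set ℕ} {m n : ℕ} (h : IsPiNumber σ n) (hmn : m ∣ n) :
    IsPiNumber σ m := fun p hp hd => h p hp (hd.trans hmn)

theorem IsPiNumber.mul {σ : Set ℕ} {m n : ℕ} (hm : IsPiNumber σ m) (hn : IsPiNumber σ n) :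
    IsPiNumber σ (m * n) := fun p hp hd => (hp.dvd_mul.1 hd).elim (hm p hp) (hn p hp)

theorem IsPiNumber.mono {σ τ : Set ℕ} (hστ : σ ⊆ τ) {n : ℕ} (h : IsPiNumber σ n) :
    IsPiNumber τ n := fun p hp hd => hστ (h p hp hd)

theorem IsPiNumber.coprime {σ : Set ℕ} {m n : ℕ} (hm : IsPiNumber σ m) (hn : IsPiNumber σᶜ n) :
    m.Coprime n :=
  Nat.Coprime.symm <| Nat.coprime_of_dvd fun p hp hpn hpm => hn p hp hpn (hm p hp hpm)

theorem isPiNumber_one {σ : Set ℕ} : IsPiNumber σ 1 :=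
  fun _ hp hd => absurd (Nat.dvd_one.1 hd) hp.ne_one

variable {H V : Type*} [Group H] [Fintype H] [AddCommGroup V] [Module ℂ V] [FiniteDimensional ℂ V]

omit [Fintype H] in
theorem card_fixedBy_fun (α : Type*) [MulAction H α] [Finite α] (N : ℕ) (x : H) :
    Nat.card (MulAction.fixedBy (Fin N → α) x) = Nat.card (MulAction.fixedBy α x) ^ N := by
  rw [← Nat.card_fin N, ← Nat.card_fun, Nat.card_fin]
  exact Nat.card_congr
    { toFun := fun s i => ⟨s.1 i, congrFun s.2 i⟩
      invFun := fun s => ⟨fun i => s i, funext fun i => (s i).2⟩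
      left_inv := fun _ => rfl
      right_inv := fun _ => rfl }

theorem card_fixedBy_quotient_modEq {q : ℕ} [hq : Fact q.Prime] (Q : Subgroup H) {x : H}
    (hx : IsPiNumber {q} (orderOf x)) :
    Q.index ≡ Nat.card (MulAction.fixedBy (H ⧸ Q) x) [MOD q] := by
  have hP : IsPGroup q (Subgroup.zpowers x) := by
    refine IsPGroup.of_card (n := (orderOf x).primeFactorsList.length) ?_
    rw [Nat.card_zpowers]
    exact Nat.eq_prime_pow_of_unique_prime_dvd (orderOf_pos x).ne' fun {p} hp hd => hx p hp hd
  have h := hP.card_modEq_card_fixedPoints (H ⧸ Q)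
  have hfix : MulAction.fixedPoints (Subgroup.zpowers x) (H ⧸ Q) =
      MulAction.fixedBy (H ⧸ Q) x := by
    ext a
    refine ⟨fun ha => ha ⟨x, Subgroup.mem_zpowers x⟩, fun ha g => ?_⟩
    obtain ⟨k, hk⟩ := Subgroup.mem_zpowers_iff.1 g.2
    have : (x ^ k) • a = a :=
      (MulAction.stabilizer H a).zpow_mem (MulAction.mem_stabilizer_iff.2 ha) k
    rw [hk] at this
    exact this
  rwa [hfix] at h

omit [Fintype H] in
theorem card_fixedBy_quotient_eq_zero {q : ℕ} [hq : Fact q.Prime] {Q : Subgroup H}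
    (hQ : IsPGroup q Q) {x : H} (hx : ¬ IsPiNumber {q} (orderOf x)) :
    Nat.card (MulAction.fixedBy (H ⧸ Q) x) = 0 := by
  rw [Nat.card_eq_zero]
  refine Or.inl ⟨fun ⟨a, ha⟩ => hx ?_⟩
  induction a using QuotientGroup.induction_on with
  | H t =>
    have h1 : (t⁻¹ * (x * t)) ∈ Q := QuotientGroup.eq.1 (Eq.symm ha)
    obtain ⟨k, hk⟩ := hQ ⟨_, h1⟩
    have h2 : (t⁻¹ * (x * t)) ^ q ^ k = 1 := congrArg Subtype.val hk
    have h3 : x ^ q ^ k = 1 := by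
      have := conj_pow (i := q ^ k) (a := t⁻¹) (b := x)
      rw [inv_inv, mul_assoc, h2] at this
      have h := congrArg (fun z => t * z * t⁻¹) this
      simpa [mul_assoc] using h.symm
    intro p hp hd
    exact (Nat.prime_dvd_prime_iff_eq hp hq.out).1
      (hp.dvd_of_dvd_pow (hd.trans (orderOf_dvd_of_pow_eq_one h3)))

open Classical in
/-- A trace version of the theorem of Frobenius on the number of `q`-elements of a group. -/
theorem isIntegral_sum_primeElements {q : ℕ} (hq : q.Prime) (ρ : Representation ℂ H V)
    {T : Module.End ℂ V} (hc : ∀ x, Commute (ρ x) T) {n : ℕ} (hn : 0 < n) (hT : T ^ n = 1) :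
    IsIntegral ℤ (((q ^ (Nat.card H).factorization q : ℕ) : ℂ)⁻¹ *
      ∑ x : H with IsPiNumber {q} (orderOf x), LinearMap.trace ℂ V (ρ x * T)) := by
  have : Fact q.Prime := ⟨hq⟩
  obtain ⟨Q⟩ : Nonempty (Sylow q H) := inferInstance
  set P := q ^ (Nat.card H).factorization q with hP
  have hP0 : (P : ℂ) ≠ 0 := by exact_mod_cast (pow_pos hq.pos _).ne'
  have hH0 : (Nat.card H : ℂ) ≠ 0 := by exact_mod_cast Nat.card_pos.ne'
  let α := H ⧸ (Q : Subgroup H)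
  let N := Nat.totient P
  have hN : N ≠ 0 := (Nat.totient_pos.2 (pow_pos hq.pos _)).ne'
  let f : H → ℕ := fun x => Nat.card (MulAction.fixedBy α x)
  have hInt : ∀ k : ℕ, IsIntegral ℤ (k : ℂ) := fun k => by
    simpa using isIntegral_algebraMap (R := ℤ) (A := ℂ) (x := (k : ℤ))
  let τ := Representation.tprod (permutationRep H (Fin N → α)) ρ
  have hI := isIntegral_average_trace τ (T := TensorProduct.map LinearMap.id T) (n := n)
    (fun x => by
      rw [commute_iff_eq]
      change _ ∘ₗ _ = _ ∘ₗ _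
      rw [Representation.tprod_apply, ← TensorProduct.map_comp, ← TensorProduct.map_comp]
      congr 1
      exact hc x) hn
    (by
      rw [TensorProduct.map_pow, hT]
      change TensorProduct.map (1 ^ n) 1 = 1
      rw [one_pow]; exact TensorProduct.map_id)
  have htr : ∀ x, LinearMap.trace ℂ _ (τ x * TensorProduct.map LinearMap.id T) =
      (f x ^ N : ℕ) * LinearMap.trace ℂ V (ρ x * T) := fun x => by
    have h1 : τ x * TensorProduct.map LinearMap.id T =
        TensorProduct.map (permutationRep H (Fin N → α) x) (ρ x * T) := by
      change _ ∘ₗ _ = _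
      rw [Representation.tprod_apply, ← TensorProduct.map_comp]
      rfl
    rw [h1, LinearMap.trace_tensorProduct', ← card_fixedBy_fun, ← character_permutationRep]
    rfl
  simp_rw [htr] at hI
  have hmod : ∀ x, IsPiNumber {q} (orderOf x) → ∃ k : ℕ, f x ^ N = 1 + P * k := fun x hx => by
    have h1 := card_fixedBy_quotient_modEq (Q : Subgroup H) hx
    have h2 : (f x).Coprime P := by
      refine Nat.Coprime.pow_right _ (Nat.Coprime.symm ((Nat.Prime.coprime_iff_not_dvd hq).2 ?_))
      intro hd
      exact Q.not_dvd_index ((Nat.ModEq.dvd_iff h1 dvd_rfl).2 hd)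
    have h3 : f x ^ N ≡ 1 [MOD P] := Nat.ModEq.pow_totient h2
    have h4 : 1 ≤ f x ^ N := Nat.one_le_iff_ne_zero.2 fun h0 => by
      have : f x = 0 := by simpa [hN] using h0
      rw [this, Nat.coprime_zero_left] at h2
      have h5 := (Nat.ModEq.dvd_iff h1 dvd_rfl).2
        (by change q ∣ f x; rw [this]; exact dvd_zero q)
      exact Q.not_dvd_index h5
    obtain ⟨k, hk⟩ := (Nat.modEq_iff_dvd' h4).1 h3.symm
    exact ⟨k, by omega⟩
  choose! k hk using hmod
  have hzero : ∀ x, ¬ IsPiNumber {q} (orderOf x) → f x ^ N = 0 := fun x hx => by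
    rw [show f x = 0 from card_fixedBy_quotient_eq_zero Q.isPGroup' hx, zero_pow hN]
  have hsum : ∑ x : H, ((f x ^ N : ℕ) : ℂ) * LinearMap.trace ℂ V (ρ x * T) =
      ∑ x : H with IsPiNumber {q} (orderOf x), LinearMap.trace ℂ V (ρ x * T) +
        P * ∑ x : H with IsPiNumber {q} (orderOf x), k x * LinearMap.trace ℂ V (ρ x * T) := by
    rw [Finset.mul_sum, ← Finset.sum_add_distrib, Finset.sum_filter]
    refine Finset.sum_congr rfl fun x _ => ?_
    split_ifs with hx
    · rw [hk x hx]; push_cast; ring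
    · rw [hzero x hx]; simp
  rw [hsum] at hI
  have hdvd : P * (Nat.card H / P) = Nat.card H := Nat.ordProj_mul_ordCompl_eq_self _ _
  have hcard : (P : ℂ)⁻¹ * Nat.card H = (Nat.card H / P : ℕ) := by
    rw [inv_mul_eq_iff_eq_mul₀ hP0, ← Nat.cast_mul, hdvd]
  have htrace : ∀ x, IsIntegral ℤ (LinearMap.trace ℂ V (ρ x * T)) := fun x => by
    refine isIntegral_trace_of_pow_eq_one (n := Nat.card H * n) (Nat.mul_pos Nat.card_pos hn) ?_
    rw [(hc x).mul_pow, pow_mul, rep_pow_card, mul_comm, pow_mul, hT, one_pow, one_pow, one_mul]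
  have hrest : IsIntegral ℤ
      (∑ x : H with IsPiNumber {q} (orderOf x), (k x : ℂ) * LinearMap.trace ℂ V (ρ x * T)) :=
    IsIntegral.sum _ fun x _ => (hInt _).mul (htrace x)
  have h := ((hInt (Nat.card H / P)).mul hI).sub hrest
  rw [← hcard] at h
  refine (congrArg (IsIntegral ℤ) ?_).mp h
  field_simp
  ring

end PrimeElements

section Parts

theorem Nat.piPart_mul_piPart_compl (σ : Set ℕ) {n : ℕ} (hn : n ≠ 0) :
    n.piPart σ * n.piPart σᶜ = n := by
  classical
  unfold Nat.piPart
  rw [← Finsupp.prod_mul]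
  conv_rhs => rw [← Nat.prod_factorization_pow_eq_self hn]
  refine Finsupp.prod_congr fun p _ => ?_
  by_cases h : p ∈ σ <;> simp [h]

theorem isPiNumber_piPart (σ : Set ℕ) (n : ℕ) : IsPiNumber σ (n.piPart σ) := by
  intro p hp hd
  unfold Nat.piPart Finsupp.prod at hd
  obtain ⟨r, hr, hd⟩ := (Prime.dvd_finsetProd_iff hp.prime _).1 hd
  dsimp only at hd
  split_ifs at hd with h
  · have hr' := Nat.prime_of_mem_primeFactors (Nat.support_factorization n ▸ hr)
    rwa [(Nat.prime_dvd_prime_iff_eq hp hr').1 (hp.dvd_of_dvd_pow hd)]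
  · exact absurd (Nat.dvd_one.1 hd) hp.ne_one

theorem Nat.piPart_pos (σ : Set ℕ) {n : ℕ} (hn : n ≠ 0) : 0 < n.piPart σ :=
  Nat.pos_of_ne_zero fun h => hn <| by rw [← Nat.piPart_mul_piPart_compl σ hn, h, zero_mul]

theorem Nat.div_piPart (σ : Set ℕ) {n : ℕ} (hn : n ≠ 0) : n / n.piPart σ = n.piPart σᶜ :=
  Nat.div_eq_of_eq_mul_right (Nat.piPart_pos σ hn) (Nat.piPart_mul_piPart_compl σ hn).symm

variable {G : Type} [Group G] [Finite G]

theorem isPiNumber_orderOf_elemPiPart (σ : Set ℕ) (g : G) :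
    IsPiNumber σ (orderOf (elemPiPart σ g)) := by
  have hn := (orderOf_pos g).ne'
  refine (isPiNumber_piPart σ (orderOf g)).of_dvd (orderOf_dvd_of_pow_eq_one ?_)
  rw [elemPiPart, Nat.div_piPart σ hn, ← pow_mul, ← orderOf_dvd_iff_pow_eq_one]
  nth_rw 1 [← Nat.piPart_mul_piPart_compl σ hn]
  rw [mul_comm]
  exact mul_dvd_mul_right
    (dvd_pow_self _ (Nat.totient_pos.2 (Nat.piPart_pos σ hn)).ne') _

theorem elemPiPart_mul_elemPiPart_compl (σ : Set ℕ) (g : G) :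
    elemPiPart σ g * elemPiPart σᶜ g = g := by
  have hn := (orderOf_pos g).ne'
  rw [elemPiPart, elemPiPart, Nat.div_piPart σ hn, Nat.div_piPart σᶜ hn, compl_compl, ← pow_add]
  conv_rhs => rw [← pow_one g]
  rw [pow_eq_pow_iff_modEq]
  set a := (orderOf g).piPart σ
  set b := (orderOf g).piPart σᶜ
  have ha : 0 < a := Nat.piPart_pos σ hn
  have hb : 0 < b := Nat.piPart_pos σᶜ hn
  have hab : a.Coprime b := (isPiNumber_piPart σ _).coprime (isPiNumber_piPart σᶜ _)
  have h1 : b ^ a.totient + a ^ b.totient ≡ 1 + 0 [MOD a] :=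
    (Nat.ModEq.pow_totient hab.symm).add
      (Nat.modEq_zero_iff_dvd.2 (dvd_pow_self _ (Nat.totient_pos.2 hb).ne'))
  have h2 : b ^ a.totient + a ^ b.totient ≡ 0 + 1 [MOD b] :=
    Nat.ModEq.add (Nat.modEq_zero_iff_dvd.2 (dvd_pow_self _ (Nat.totient_pos.2 ha).ne'))
      (Nat.ModEq.pow_totient hab)
  rw [← Nat.piPart_mul_piPart_compl σ hn]
  exact (Nat.modEq_and_modEq_iff_modEq_mul hab).1 ⟨h1, h2⟩

omit [Finite G] in
theorem commute_elemPiPart_of_commute {x g : G} (σ : Set ℕ) (h : Commute x g) :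
    Commute x (elemPiPart σ g) := h.pow_right _

theorem elemPiPart_mul_of_commute {σ : Set ℕ} {x y : G} (hxy : Commute x y)
    (hx : IsPiNumber σ (orderOf x)) (hy : IsPiNumber σᶜ (orderOf y)) :
    elemPiPart σ (x * y) = x := by
  set z := elemPiPart σ (x * y) with hz
  set w := elemPiPart σᶜ (x * y) with hw
  have hzw : z * w = x * y := elemPiPart_mul_elemPiPart_compl σ _
  have hxz : Commute x⁻¹ z :=
    (commute_elemPiPart_of_commute σ ((Commute.refl x).mul_right hxy)).inv_left
  have hyw : Commute y w⁻¹ :=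
    (commute_elemPiPart_of_commute σᶜ (hxy.symm.mul_right (Commute.refl y))).inv_right
  have he : x⁻¹ * z = y * w⁻¹ := by
    rw [eq_mul_inv_iff_mul_eq, mul_assoc, hzw, inv_mul_cancel_left]
  have h1 : IsPiNumber σ (orderOf (x⁻¹ * z)) := by
    refine IsPiNumber.of_dvd ?_ (hxz.orderOf_mul_dvd_mul_orderOf)
    rw [orderOf_inv]
    exact hx.mul (isPiNumber_orderOf_elemPiPart σ _)
  have h2 : IsPiNumber σᶜ (orderOf (x⁻¹ * z)) := by
    rw [he]
    refine IsPiNumber.of_dvd ?_ (hyw.orderOf_mul_dvd_mul_orderOf)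
    rw [orderOf_inv]
    exact hy.mul (isPiNumber_orderOf_elemPiPart σᶜ _)
  have h3 : x⁻¹ * z = 1 := orderOf_eq_one_iff.1 ((Nat.coprime_self _).1 (h1.coprime h2))
  exact (inv_mul_eq_one.1 h3).symm

theorem elemPiPart_compl_mul_of_commute {σ : Set ℕ} {x y : G} (hxy : Commute x y)
    (hx : IsPiNumber σ (orderOf x)) (hy : IsPiNumber σᶜ (orderOf y)) :
    elemPiPart σᶜ (x * y) = y := by
  have := elemPiPart_mul_elemPiPart_compl σ (x * y)
  rw [elemPiPart_mul_of_commute hxy hx hy] at this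
  exact mul_left_cancel this

omit [Finite G] in
theorem elemPiPart_conj (σ : Set ℕ) (g h : G) :
    elemPiPart σ (h * g * h⁻¹) = h * elemPiPart σ g * h⁻¹ := by
  have : orderOf (h * g * h⁻¹) = orderOf g := by
    have := orderOf_injective (MulAut.conj h).toMonoidHom (MulAut.conj h).injective g
    simpa using this
  rw [elemPiPart, elemPiPart, this, conj_pow]

omit [Finite G] in
theorem commute_elemPiPart_elemPiPart (σ τ : Set ℕ) (g : G) :
    Commute (elemPiPart σ g) (elemPiPart τ g) :=
  (Commute.refl g).pow_pow _ _

theorem elemPiPart_of_isPiNumber {σ : Set ℕ} {g : G} (hg : IsPiNumber σ (orderOf g)) :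
    elemPiPart σ g = g := by
  have := elemPiPart_mul_of_commute (Commute.one_right g) hg (by rw [orderOf_one]; exact isPiNumber_one)
  rwa [mul_one] at this

theorem elemPiPart_of_isPiNumber_compl {σ : Set ℕ} {g : G} (hg : IsPiNumber σᶜ (orderOf g)) :
    elemPiPart σ g = 1 := by
  have := elemPiPart_mul_of_commute (σ := σ) (Commute.one_left g)
    (by rw [orderOf_one]; exact isPiNumber_one) hg
  rwa [one_mul] at this

end Parts

section Integrality

variable {G : Type} {V : Type*} [Group G] [Fintype G] [AddCommGroup V] [Module ℂ V] [FiniteDimensional ℂ V]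

omit [Fintype G] in
theorem card_conj_mul_card_centralizer [Finite G] (y : G) :
    Nat.card {x // IsConj y x} * Nat.card (Subgroup.centralizer {y}) = Nat.card G := by
  rw [Subgroup.nat_card_centralizer_nat_card_stabilizer]
  have h := Nat.card_congr (MulAction.orbitProdStabilizerEquivGroup (ConjAct G) y)
  rw [Nat.card_prod] at h
  have h' : Nat.card {x // IsConj y x} = Nat.card (MulAction.orbit (ConjAct G) y) :=
    Nat.card_congr (Equiv.subtypeEquivRight fun x => by
      rw [ConjAct.mem_orbit_conjAct, isConj_comm])
  rw [h', h]
  exact Nat.card_congr ConjAct.ofConjAct.toEquiv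

open Classical in
theorem isIntegral_mul_sum_of_isConj {c : ℂ} {f : G → ℂ} (hf : ∀ x y, IsConj x y → f x = f y)
    (h : ∀ y, IsIntegral ℤ (c * (Nat.card {x // IsConj y x} * f y))) :
    IsIntegral ℤ (c * ∑ y, f y) := by
  rw [← Finset.sum_fiberwise Finset.univ (ConjClasses.mk : G → ConjClasses G) f, Finset.mul_sum]
  refine IsIntegral.sum _ fun K _ => ?_
  obtain ⟨y, rfl⟩ := ConjClasses.exists_rep K
  rw [Finset.sum_congr rfl (g := fun _ => f y) fun x hx =>
    hf x y (ConjClasses.mk_eq_mk_iff_isConj.1 (Finset.mem_filter.1 hx).2), Finset.sum_const,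
    nsmul_eq_mul]
  have hcard : (Finset.univ.filter fun x => ConjClasses.mk x = ConjClasses.mk y).card =
      Nat.card {x // IsConj y x} := by
    rw [Nat.card_eq_fintype_card, Fintype.card_subtype]
    refine congrArg _ (Finset.filter_congr fun x _ => ?_)
    rw [ConjClasses.mk_eq_mk_iff_isConj, isConj_comm]
  rw [hcard]
  exact h y

open Classical in
theorem isIntegral_sum_character {q : ℕ} (hq : q.Prime) {σ : Set ℕ} (hσ : q ∈ σ)
    (ρ : Representation ℂ G V) :
    IsIntegral ℤ (((q ^ (Nat.card G).factorization q : ℕ) : ℂ)⁻¹ *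
      ∑ s : G with IsPiNumber σ (orderOf s), ρ.character s) := by
  have hqσ : ({q} : Set ℕ) ⊆ σ := Set.singleton_subset_iff.2 hσ
  let F : G → Finset G := fun y => Finset.univ.filter
    fun s => IsPiNumber σ (orderOf s) ∧ elemPiPart {q}ᶜ s = y
  have hsum : ∑ s : G with IsPiNumber σ (orderOf s), ρ.character s =
      ∑ y, ∑ s ∈ F y, ρ.character s := by
    rw [← Finset.sum_fiberwise _ (elemPiPart {q}ᶜ)]
    refine Finset.sum_congr rfl fun y _ => ?_
    rw [Finset.filter_filter]
  rw [hsum]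
  refine isIntegral_mul_sum_of_isConj (fun y z hyz => ?_) fun y => ?_
  · obtain ⟨h, rfl⟩ := isConj_iff.1 hyz
    refine Finset.sum_equiv (MulAut.conj h).toEquiv (fun s => ?_) fun s _ => ?_
    · have ho : orderOf (h * s * h⁻¹) = orderOf s := by
        simpa using orderOf_injective (MulAut.conj h).toMonoidHom (MulAut.conj h).injective s
      simp [F, ho, elemPiPart_conj]
    · exact (Representation.char_conj ρ s h).symm
  · by_cases hy : IsPiNumber σ (orderOf y) ∧ IsPiNumber {q}ᶜ (orderOf y)
    · let C := Subgroup.centralizer {y}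
      have hC : ∀ u : C, Commute (u : G) y := fun u => Subgroup.mem_centralizer_singleton_iff.1 u.2
      have hF : ∑ s ∈ F y, ρ.character s = ∑ u : C with IsPiNumber {q} (orderOf u),
          LinearMap.trace ℂ V ((ρ.comp C.subtype) u * ρ y) := by
        symm
        refine Finset.sum_nbij (fun u => (u : G) * y) (fun u hu => ?_)
          (fun u _ v _ huv => Subtype.ext (mul_right_cancel huv)) (fun s hs => ?_) fun u _ => ?_
        · have hu : IsPiNumber {q} (orderOf (u : G)) := by
            simpa using (Finset.mem_filter.1 hu).2
          refine Finset.mem_filter.2 ⟨Finset.mem_univ _, ?_, ?_⟩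
          · exact ((hu.mono hqσ).mul hy.1).of_dvd (hC u).orderOf_mul_dvd_mul_orderOf
          · exact elemPiPart_compl_mul_of_commute (hC u) hu hy.2
        · obtain ⟨_, hs1, rfl⟩ := Finset.mem_filter.1 (Finset.mem_coe.1 hs)
          refine ⟨⟨elemPiPart {q} s, Subgroup.mem_centralizer_singleton_iff.2
            (commute_elemPiPart_elemPiPart _ _ s)⟩, ?_, elemPiPart_mul_elemPiPart_compl _ s⟩
          simpa using isPiNumber_orderOf_elemPiPart {q} s
        · change _ = LinearMap.trace ℂ V (ρ (u * y))
          rw [map_mul ρ]; rfl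
      have hI := isIntegral_sum_primeElements hq (ρ.comp C.subtype) (T := ρ y)
        (fun u => by
          change ρ u * ρ y = ρ y * ρ u
          rw [← map_mul, ← map_mul, hC u]) (Nat.card_pos (α := G)) (rep_pow_card ρ y)
      rw [← hF] at hI
      have hcard := card_conj_mul_card_centralizer y
      have h0 : Nat.card {x // IsConj y x} ≠ 0 := left_ne_zero_of_mul (hcard ▸ Nat.card_pos.ne')
      have h1 : Nat.card C ≠ 0 := Nat.card_pos.ne'
      have hq0 : (q : ℂ) ≠ 0 := by exact_mod_cast hq.ne_zero
      rw [← hcard, Nat.factorization_mul h0 h1, Finsupp.add_apply]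
      obtain ⟨r, hr⟩ := Nat.ordProj_dvd (Nat.card {x // IsConj y x}) q
      have hr' : (Nat.card {x // IsConj y x} : ℂ) =
          q ^ (Nat.card {x // IsConj y x}).factorization q * r := by exact_mod_cast hr
      have := (isIntegral_algebraMap (R := ℤ) (A := ℂ) (x := (r : ℤ))).mul hI
      refine (congrArg (IsIntegral ℤ) ?_).mp this
      rw [hr', pow_add]
      push_cast
      field_simp
    · have : F y = ∅ := by
        refine Finset.filter_eq_empty_iff.2 fun s _ hs => hy ?_
        rw [← hs.2]
        refine ⟨hs.1.of_dvd ?_, isPiNumber_orderOf_elemPiPart _ s⟩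
        exact orderOf_pow_dvd _
      simp [this, isIntegral_zero]

theorem isIntegral_of_forall_prime {b : ℂ} {k : ℕ} (hk : k ≠ 0) (hb : IsIntegral ℤ ((k : ℂ) * b))
    (h : ∀ q : ℕ, q.Prime → q ∣ k → ∃ l : ℕ, l.Coprime q ∧ IsIntegral ℤ ((l : ℂ) * b)) :
    IsIntegral ℤ b := by
  induction k using Nat.strong_induction_on with
  | _ k ih =>
    rcases eq_or_ne k 1 with rfl | h1
    · simpa using hb
    obtain ⟨q, hq, r, rfl⟩ := Nat.exists_prime_and_dvd h1
    have hr : r ≠ 0 := right_ne_zero_of_mul hk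
    refine ih r (lt_mul_of_one_lt_left (Nat.pos_of_ne_zero hr) hq.one_lt) hr ?_
      fun p hp hd => h p hp (hd.mul_left _)
    obtain ⟨l, hl, hlb⟩ := h q hq (dvd_mul_right _ _)
    have hz := Nat.gcd_eq_gcd_ab l q
    rw [hl] at hz
    have hzC : (1 : ℂ) = l * (l.gcdA q : ℂ) + q * (l.gcdB q : ℂ) := by exact_mod_cast hz
    have hInt : ∀ z : ℤ, IsIntegral ℤ (z : ℂ) := fun z => isIntegral_algebraMap
    have := ((hInt (r * l.gcdA q)).mul hlb).add ((hInt (l.gcdB q)).mul hb)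
    refine (congrArg (IsIntegral ℤ) ?_).mp this
    calc _ = (r : ℂ) * b * (l * (l.gcdA q : ℂ) + q * (l.gcdB q : ℂ)) := by push_cast; ring
      _ = _ := by rw [← hzC, mul_one]

open Classical in
theorem isIntegral_index_inv_mul_sum {W : Type*} [AddCommGroup W] [Module ℂ W]
    [FiniteDimensional ℂ W] {π : Set ℕ} {N : Subgroup G}
    (ρ : Representation ℂ G V) (τ : Representation ℂ G W)
    (hρ : (Nat.card G : ℂ)⁻¹ * ∑ g : G, ρ.character g * ρ.character g⁻¹ = 1) {m : ℕ}
    (hm : ρ.character 1 = m) (hmN : m.piPart π = N.index.piPart π) :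
    IsIntegral ℤ ((N.index : ℂ)⁻¹ *
      ∑ s : G with IsPiNumber πᶜ (orderOf s), ρ.character s * τ.character s⁻¹) := by
  set S := ∑ s : G with IsPiNumber πᶜ (orderOf s), ρ.character s * τ.character s⁻¹ with hS
  have hInt : ∀ k : ℕ, IsIntegral ℤ (k : ℂ) := fun k => by
    simpa using isIntegral_algebraMap (R := ℤ) (A := ℂ) (x := (k : ℤ))
  have hm0 : m ≠ 0 := by
    rintro rfl
    rw [Representation.char_one, Nat.cast_inj] at hm
    have : Subsingleton V := Module.finrank_zero_iff.1 hm
    have h0 : ∀ g, ρ.character g = 0 := fun g => by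
      rw [Representation.character, Subsingleton.elim (ρ g) 0, map_zero]
    simp [h0] at hρ
  have hi0 : N.index ≠ 0 := Subgroup.index_ne_zero_of_finite
  have hmC : (m : ℂ) ≠ 0 := by exact_mod_cast hm0
  have hiC : (N.index : ℂ) ≠ 0 := by exact_mod_cast hi0
  have hSm : IsIntegral ℤ ((m : ℂ)⁻¹ * S) := by
    rw [hS, Finset.sum_filter]
    refine isIntegral_mul_sum_of_isConj (fun y z hyz => ?_) fun y => ?_
    · obtain ⟨h, rfl⟩ := isConj_iff.1 hyz
      have ho : orderOf (h * y * h⁻¹) = orderOf y := by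
        simpa using orderOf_injective (MulAut.conj h).toMonoidHom (MulAut.conj h).injective y
      rw [ho, Representation.char_conj, conj_inv, Representation.char_conj]
    · split_ifs
      · have := (isIntegral_card_mul_character_div ρ hρ y).mul (isIntegral_character τ y⁻¹)
        rw [hm] at this
        refine (congrArg (IsIntegral ℤ) ?_).mp this
        ring
      · simp [isIntegral_zero]
  refine isIntegral_of_forall_prime (Nat.piPart_pos πᶜ hi0).ne' ?_ fun q hq hd => ?_
  · have hm' : (m : ℂ) = m.piPart π * m.piPart πᶜ := by
      exact_mod_cast (Nat.piPart_mul_piPart_compl π hm0).symm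
    have hi' : (N.index : ℂ) = N.index.piPart π * N.index.piPart πᶜ := by
      exact_mod_cast (Nat.piPart_mul_piPart_compl π hi0).symm
    refine (congrArg (IsIntegral ℤ) ?_).mp ((hInt (m.piPart πᶜ)).mul hSm)
    have h1 := hmC
    have h2 := hiC
    rw [hm', mul_ne_zero_iff] at h1
    rw [hi', mul_ne_zero_iff] at h2
    have h3 := h1.1
    have h4 := h1.2
    have h5 := h2.2
    rw [hm', hi', hmN]
    rw [hmN] at h3
    field_simp
  · have hqπ : q ∈ πᶜ := isPiNumber_piPart _ _ q hq hd
    refine ⟨Nat.card G / q ^ (Nat.card G).factorization q,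
      (Nat.coprime_ordCompl hq Nat.card_pos.ne').symm, ?_⟩
    have h := isIntegral_sum_character hq hqπ (Representation.tprod ρ τ.dual)
    simp only [Representation.char_tensor, Pi.mul_apply, Representation.char_dual] at h
    rw [← hS] at h
    have hq0 : (q : ℂ) ≠ 0 := by exact_mod_cast hq.ne_zero
    have hcard : (Nat.card N : ℂ) * N.index = q ^ (Nat.card G).factorization q *
        (Nat.card G / q ^ (Nat.card G).factorization q : ℕ) := by
      exact_mod_cast N.card_mul_index.trans (Nat.ordProj_mul_ordCompl_eq_self _ _).symm
    refine (congrArg (IsIntegral ℤ) ?_).mp ((hInt (Nat.card N)).mul h)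
    push_cast
    field_simp
    linear_combination S * hcard

end Integrality

section Central

variable {G : Type} [Group G]

theorem charInner_character [Fintype G] {V : Type*} [AddCommGroup V] [Module ℂ V]
    [FiniteDimensional ℂ V] (f : G → ℂ) (ρ : Representation ℂ G V) :
    charInner G f ρ.character = (Nat.card G : ℂ)⁻¹ * ∑ g, f g * ρ.character g⁻¹ := by
  rw [charInner, finsum_eq_sum_of_fintype]
  simp_rw [conj_character]

theorem IsIrrChar.exists_representation [Fintype G] {χ : G → ℂ} (h : IsIrrChar G χ) :
    ∃ (V : Type) (_ : AddCommGroup V) (_ : Module ℂ V) (_ : FiniteDimensional ℂ V)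
      (ρ : Representation ℂ G V), χ = ρ.character ∧
        (Nat.card G : ℂ)⁻¹ * ∑ g : G, ρ.character g * ρ.character g⁻¹ = 1 := by
  obtain ⟨⟨V, hV⟩, h1⟩ := h
  have he : χ = Representation.character V.ρ := funext hV
  refine ⟨V, inferInstance, inferInstance, inferInstance, V.ρ, he, ?_⟩
  rwa [he, charInner_character] at h1

theorem isIrrChar_character [Fintype G] {V : Type} [AddCommGroup V] [Module ℂ V]
    [FiniteDimensional ℂ V] (ρ : Representation ℂ G V)
    (hρ : (Nat.card G : ℂ)⁻¹ * ∑ g : G, ρ.character g * ρ.character g⁻¹ = 1) :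
    IsIrrChar G ρ.character :=
  ⟨⟨FDRep.of ρ, fun _ => rfl⟩, by rwa [charInner_character]⟩

variable {A : Type} [Group A] {V : Type} [AddCommGroup V] [Module ℂ V] [FiniteDimensional ℂ V]

omit [FiniteDimensional ℂ V] in
theorem nontrivial_of_norm_eq_one [Fintype G] (ρ : Representation ℂ G V)
    (hρ : (Nat.card G : ℂ)⁻¹ * ∑ g : G, ρ.character g * ρ.character g⁻¹ = 1) : Nontrivial V := by
  by_contra h
  have : Subsingleton V := not_nontrivial_iff_subsingleton.1 h
  have h0 : ∀ g, ρ.character g = 0 := fun g => by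
    rw [Representation.character, Subsingleton.elim (ρ g) 0, map_zero]
  simp [h0] at hρ

theorem exists_central_character [Fintype G] (ρ : Representation ℂ G V)
    (hρ : (Nat.card G : ℂ)⁻¹ * ∑ g : G, ρ.character g * ρ.character g⁻¹ = 1)
    (f : A →* G) (hf : ∀ a x, Commute x (f a)) :
    ∃ c : A →* ℂ, ∀ a, ρ (f a) = c a • 1 := by
  have : Nontrivial V := nontrivial_of_norm_eq_one ρ hρ
  have h : ∀ a, ∃ c : ℂ, ρ (f a) = c • 1 := fun a =>
    exists_smul_of_commute ρ hρ fun x => by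
      rw [commute_iff_eq, ← map_mul ρ, ← map_mul ρ, hf a x]
  choose c hc using h
  have hinj : Function.Injective fun z : ℂ => z • (1 : Module.End ℂ V) :=
    smul_left_injective ℂ one_ne_zero
  refine ⟨⟨⟨c, hinj ?_⟩, fun a b => hinj ?_⟩, hc⟩
  · change c 1 • (1 : Module.End ℂ V) = (1 : ℂ) • 1
    rw [← hc, map_one, map_one, one_smul]
  · change c (a * b) • (1 : Module.End ℂ V) = (c a * c b) • 1
    rw [← hc, map_mul, map_mul, hc, hc, smul_mul_smul_comm, one_mul]

omit [FiniteDimensional ℂ V] in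
theorem character_mul_of_apply_eq_smul (ρ : Representation ℂ G V) {x : G} {c : ℂ}
    (hx : ρ x = c • 1) (g : G) : ρ.character (x * g) = c * ρ.character g := by
  rw [Representation.character, map_mul ρ, hx, smul_mul_assoc, one_mul, map_smul]
  rfl

theorem sum_mul_apply_inv [Fintype A] (c d : A →* ℂ) :
    (∑ a, c a * d a⁻¹ = Nat.card A ∧ c = d) ∨ ∑ a, c a * d a⁻¹ = 0 := by
  classical
  let e : A →* ℂ :=
    { toFun := fun a => c a * d a⁻¹
      map_one' := by simp
      map_mul' := fun a b => by rw [mul_inv_rev, map_mul, map_mul]; ring }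
  by_cases he : e = 1
  · have h : ∀ a, c a * d a⁻¹ = 1 := fun a => DFunLike.congr_fun he a
    refine Or.inl ⟨by simp_rw [h]; simp, MonoidHom.ext fun a => ?_⟩
    have h1 : d a⁻¹ * d a = 1 := by rw [← map_mul, inv_mul_cancel, map_one]
    linear_combination d a * h a - c a * h1
  · exact Or.inr (sum_hom_units_eq_zero e he)

theorem IsIrrChar.exists_monoidHom [Finite A] (hA : ∀ a b : A, Commute a b) {θ : A → ℂ}
    (hθ : IsIrrChar A θ) : ∃ c : A →* ℂ, θ = c := by
  have := Fintype.ofFinite A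
  obtain ⟨V, _, _, _, ρ, rfl, hρ⟩ := hθ.exists_representation
  obtain ⟨c, hc⟩ := exists_central_character ρ hρ (MonoidHom.id A) fun a x => hA x a
  have hchar : ∀ a, ρ.character a = c a * ρ.character 1 := fun a => by
    rw [← character_mul_of_apply_eq_smul ρ (hc a), MonoidHom.id_apply, mul_one]
  have h1 : ρ.character 1 * ρ.character 1 = 1 := by
    rw [← hρ, Finset.sum_congr rfl (g := fun _ => ρ.character 1 * ρ.character 1) fun a _ => by
      rw [hchar a, hchar a⁻¹]
      have : c a * c a⁻¹ = 1 := by rw [← map_mul, mul_inv_cancel, map_one]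
      linear_combination ρ.character 1 * ρ.character 1 * this]
    have h0 : (Nat.card A : ℂ) ≠ 0 := by exact_mod_cast Nat.card_pos.ne'
    rw [Finset.sum_const, nsmul_eq_mul, Finset.card_univ, ← Nat.card_eq_fintype_card,
      inv_mul_cancel_left₀ h0]
  have h2 : ρ.character 1 = 1 := by
    rw [Representation.char_one] at h1 ⊢
    have : Module.finrank ℂ V * Module.finrank ℂ V = 1 := by exact_mod_cast h1
    exact_mod_cast Nat.eq_one_of_mul_eq_one_left this
  exact ⟨c, funext fun a => by rw [hchar, h2, mul_one]⟩

theorem norm_apply_eq_one [Finite A] (c : A →* ℂ) (a : A) : ‖c a‖ = 1 :=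
  Complex.norm_eq_one_of_pow_eq_one (n := Nat.card A)
    (by rw [← map_pow, pow_card_eq_one', map_one]) Nat.card_pos.ne'

variable [Fintype G] {N : Subgroup G}

theorem apply_eq_smul_of_charInner_ne_zero (hN : N ≤ Subgroup.center G) (ρ : Representation ℂ G V)
    (hρ : (Nat.card G : ℂ)⁻¹ * ∑ g : G, ρ.character g * ρ.character g⁻¹ = 1) {μ : N →* ℂ}
    (h : charInner N (fun n => ρ.character n) μ ≠ 0) (n : N) : ρ n = μ n • 1 := by
  classical
  obtain ⟨c, hc⟩ := exists_central_character ρ hρ N.subtype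
    fun a x => (Subgroup.mem_center_iff.1 (hN a.2) x)
  suffices c = μ by rw [← this]; exact hc n
  have hchar : ∀ n : N, ρ.character n = c n * ρ.character 1 := fun n => by
    rw [← character_mul_of_apply_eq_smul ρ (hc n), Subgroup.subtype_apply, mul_one]
  have hconj : ∀ n : N, starRingEnd ℂ (μ n) = μ n⁻¹ := fun n => by
    rw [← Complex.inv_eq_conj (norm_apply_eq_one μ n)]
    exact inv_eq_of_mul_eq_one_right (by rw [← map_mul, mul_inv_cancel, map_one])
  rcases sum_mul_apply_inv c μ with h1 | h1
  · exact h1.2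
  · refine absurd ?_ h
    rw [charInner, finsum_eq_sum_of_fintype]
    have he : ∀ n : N, ρ.character n * starRingEnd ℂ (μ n) = c n * μ n⁻¹ * ρ.character 1 :=
      fun n => by rw [hchar, hconj, mul_right_comm]
    simp_rw [he, ← Finset.sum_mul, h1, zero_mul, mul_zero]

theorem charInner_ne_zero_of_forall_eq {f : G → ℂ} {μ : N →* ℂ} (hf : f 1 ≠ 0)
    (h : ∀ n : N, f n = μ n * f 1) : charInner N (fun n => f n) μ ≠ 0 := by
  classical
  have hc : (Nat.card N : ℂ) ≠ 0 := by exact_mod_cast Nat.card_pos.ne'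
  have hn : ∀ n : N, f n * starRingEnd ℂ (μ n) = f 1 := fun n => by
    rw [h, mul_right_comm, Complex.mul_conj, Complex.normSq_eq_norm_sq, norm_apply_eq_one]
    simp
  rw [charInner, finsum_eq_sum_of_fintype]
  simp_rw [hn]
  rw [Finset.sum_const, nsmul_eq_mul, Finset.card_univ, ← Nat.card_eq_fintype_card,
    inv_mul_cancel_left₀ hc]
  exact hf

end Central

section Conjugates

/-- The cyclotomic field of `n`th roots of unity inside `ℂ`. -/
def rootsField (n : ℕ) : IntermediateField ℚ ℂ := IntermediateField.adjoin ℚ {z : ℂ | z ^ n = 1}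

theorem numberField_rootsField {n : ℕ} (hn : 0 < n) : NumberField (rootsField n) where
  to_charZero := inferInstance
  to_finiteDimensional := by
    have hfin : Finite {z : ℂ | z ^ n = 1} := by
      refine Set.Finite.subset (Polynomial.nthRoots n (1 : ℂ)).toFinset.finite_toSet fun z hz => ?_
      simpa [Polynomial.mem_nthRoots hn] using hz
    refine IntermediateField.finiteDimensional_adjoin fun z hz => ?_
    refine ⟨Polynomial.X ^ n - 1, by simpa using Polynomial.monic_X_pow_sub_C (1 : ℚ) hn.ne', ?_⟩
    have hz' : z ^ n = 1 := hz
    simp [hz']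

/-- The elements of the cyclotomic field on which every embedding commutes with complex
conjugation. -/
def conjSubring (n : ℕ) : Subring ℂ where
  carrier := {x | ∃ y z : rootsField n, (y : ℂ) = x ∧ (z : ℂ) = starRingEnd ℂ x ∧
    ∀ φ : rootsField n →+* ℂ, φ z = starRingEnd ℂ (φ y)}
  mul_mem' := by
    rintro _ _ ⟨y, z, rfl, hz, h⟩ ⟨y', z', rfl, hz', h'⟩
    exact ⟨y * y', z * z', by simp, by simp [hz, hz'], fun φ => by simp [h, h']⟩
  one_mem' := ⟨1, 1, by simp, by simp, by simp⟩
  add_mem' := by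
    rintro _ _ ⟨y, z, rfl, hz, h⟩ ⟨y', z', rfl, hz', h'⟩
    exact ⟨y + y', z + z', by simp, by simp [hz, hz'], fun φ => by simp [h, h']⟩
  zero_mem' := ⟨0, 0, by simp, by simp, by simp⟩
  neg_mem' := by
    rintro _ ⟨y, z, rfl, hz, h⟩
    exact ⟨-y, -z, by simp, by simp [hz], fun φ => by simp [h]⟩

theorem mem_conjSubring_of_pow_eq_one {n : ℕ} (hn : 0 < n) {z : ℂ} (hz : z ^ n = 1) :
    z ∈ conjSubring n := by
  have hmem : z ∈ rootsField n := IntermediateField.subset_adjoin ℚ _ hz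
  refine ⟨⟨z, hmem⟩, ⟨z, hmem⟩⁻¹, rfl, ?_, fun φ => ?_⟩
  · rw [← Complex.inv_eq_conj (Complex.norm_eq_one_of_pow_eq_one hz hn.ne')]
    rfl
  · rw [map_inv₀, ← Complex.inv_eq_conj]
    refine Complex.norm_eq_one_of_pow_eq_one (n := n) ?_ hn.ne'
    rw [← map_pow, show (⟨z, hmem⟩ : rootsField n) ^ n = 1 from Subtype.ext hz, map_one]

theorem trace_mem_conjSubring {V : Type*} [AddCommGroup V] [Module ℂ V] [FiniteDimensional ℂ V]
    {T : Module.End ℂ V} {n : ℕ} (hn : 0 < n) (hT : T ^ n = 1) :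
    LinearMap.trace ℂ V T ∈ conjSubring n := by
  obtain ⟨s, d, hs, h⟩ := exists_trace_pow_eq_sum hn hT
  have h1 := h 1
  simp only [pow_one] at h1
  rw [h1]
  exact Subring.sum_mem _ fun z hz =>
    Subring.mul_mem _ (natCast_mem _ _) (mem_conjSubring_of_pow_eq_one hn (hs z hz))

theorem norm_sq_sum_le {ι : Type*} [Fintype ι] (f h : ι → ℂ) (A : Finset ι) {r : ℝ} (hr : 0 ≤ r)
    (hf : ∑ i, ‖f i‖ ^ 2 = r) (hh : ∑ i, ‖h i‖ ^ 2 = r) :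
    ‖∑ i ∈ A, f i * starRingEnd ℂ (h i)‖ ≤ r := by
  have h1 : ‖∑ i ∈ A, f i * starRingEnd ℂ (h i)‖ ≤ ∑ i ∈ A, ‖f i‖ * ‖h i‖ :=
    (norm_sum_le _ _).trans_eq (by simp)
  have h2 : ∑ i ∈ A, ‖f i‖ * ‖h i‖ ≤ ∑ i, ‖f i‖ * ‖h i‖ :=
    Finset.sum_le_sum_of_subset_of_nonneg (Finset.subset_univ _) fun i _ _ => by positivity
  have h3 := Finset.sum_mul_sq_le_sq_mul_sq Finset.univ (fun i => ‖f i‖) fun i => ‖h i‖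
  rw [hf, hh] at h3
  nlinarith [abs_le_of_sq_le_sq (h3.trans_eq (sq r).symm) hr, le_abs_self (∑ i, ‖f i‖ * ‖h i‖)]

theorem norm_eq_one_of_isIntegral {ι : Type*} [Fintype ι] {n r : ℕ} (hn : 0 < n) (hr : r ≠ 0)
    {f h : ι → ℂ} (hfn : ∀ i, f i ∈ conjSubring n) (hhn : ∀ i, h i ∈ conjSubring n)
    (hf : ∑ i, f i * starRingEnd ℂ (f i) = r) (hh : ∑ i, h i * starRingEnd ℂ (h i) = r)
    {A : Finset ι} {b : ℂ} (hb : r * b = ∑ i ∈ A, f i * starRingEnd ℂ (h i))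
    (hInt : IsIntegral ℤ b) (hb0 : b ≠ 0) : ‖b‖ = 1 := by
  have := numberField_rootsField hn
  choose F F' hF hF' hFφ using hfn
  choose H H' hH hH' hHφ using hhn
  have hrC : (r : ℂ) ≠ 0 := by exact_mod_cast hr
  have hrK : (r : rootsField n) ≠ 0 := by exact_mod_cast hr
  have coe_sum : ∀ (s : Finset ι) (g : ι → rootsField n),
      ((∑ i ∈ s, g i : rootsField n) : ℂ) = ∑ i ∈ s, (g i : ℂ) :=
    fun s g => map_sum (rootsField n).val g s
  let B : rootsField n := (r : rootsField n)⁻¹ * ∑ i ∈ A, F i * H' i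
  have hB : (B : ℂ) = b := by
    have : (B : ℂ) = (r : ℂ)⁻¹ * ∑ i ∈ A, f i * starRingEnd ℂ (h i) := by
      simp [B, coe_sum, hF, hH']
    rw [this, ← hb, inv_mul_cancel_left₀ hrC]
  have hBint : IsIntegral ℤ B :=
    (isIntegral_algHom_iff ((rootsField n).val.restrictScalars ℤ) Subtype.val_injective).1
      (by change IsIntegral ℤ (B : ℂ); rwa [hB])
  have hnorm : ∀ (g : ι → ℂ) (Y Z : ι → rootsField n), (∀ i, (Y i : ℂ) = g i) →
      (∀ i, (Z i : ℂ) = starRingEnd ℂ (g i)) → ∑ i, g i * starRingEnd ℂ (g i) = r →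
      ∀ φ : rootsField n →+* ℂ, (∀ i, φ (Z i) = starRingEnd ℂ (φ (Y i))) →
      ∑ i, ‖φ (Y i)‖ ^ 2 = r := fun g Y Z hY hZ hg φ hφ => by
    have h1 : ∑ i, Y i * Z i = r := Subtype.ext (by simp [coe_sum, hY, hZ, hg])
    have h2 := congrArg φ h1
    rw [map_sum, map_natCast] at h2
    simp only [map_mul, hφ, Complex.mul_conj, Complex.normSq_eq_norm_sq] at h2
    exact_mod_cast h2
  have hφ : ∀ φ : rootsField n →+* ℂ, ‖φ B‖ ≤ 1 := fun φ => by
    have h1 := norm_sq_sum_le (fun i => φ (F i)) (fun i => φ (H i)) A (Nat.cast_nonneg r)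
      (hnorm f F F' hF hF' hf φ fun i => hFφ i φ) (hnorm h H H' hH hH' hh φ fun i => hHφ i φ)
    have h2 : φ B = (r : ℂ)⁻¹ * ∑ i ∈ A, φ (F i) * starRingEnd ℂ (φ (H i)) := by
      simp [B, hHφ]
    have hr' : (0 : ℝ) < r := by exact_mod_cast Nat.pos_of_ne_zero hr
    rw [h2, norm_mul, norm_inv, Complex.norm_natCast, inv_mul_le_iff₀ hr', mul_one]
    exact h1
  have hB0 : B ≠ 0 := fun h0 => hb0 (by rw [← hB, h0]; rfl)
  obtain ⟨k, hk, hBk⟩ := NumberField.Embeddings.pow_eq_one_of_norm_le_one _ ℂ hB0 hBint hφ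
  refine Complex.norm_eq_one_of_pow_eq_one (n := k) ?_ hk.ne'
  rw [← hB]
  exact_mod_cast congrArg Subtype.val hBk

open Classical in
theorem eq_mul_of_norm_eq_one {ι : Type*} [Fintype ι] {r : ℕ} {f h : ι → ℂ}
    (hf : ∑ i, f i * starRingEnd ℂ (f i) = r) (hh : ∑ i, h i * starRingEnd ℂ (h i) = r)
    {A : Finset ι} {b : ℂ} (hb : r * b = ∑ i ∈ A, f i * starRingEnd ℂ (h i)) (hb1 : ‖b‖ = 1)
    (i : ι) : f i = b * h i ∧ (i ∉ A → f i = 0) := by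
  set u : ι → ℂ := fun i => if i ∈ A then f i else 0 with hu
  have hb' : ∑ i, u i * starRingEnd ℂ (h i) = r * b := by
    rw [hb]
    simp [hu, ite_mul, Finset.sum_ite_mem]
  have hb2 : ∑ i, h i * starRingEnd ℂ (u i) = r * starRingEnd ℂ b := by
    have := congrArg (starRingEnd ℂ) hb'
    rw [map_sum, map_mul, map_natCast] at this
    rw [← this]
    exact Finset.sum_congr rfl fun i _ => by rw [map_mul, Complex.conj_conj, mul_comm]
  have hbb : b * starRingEnd ℂ b = 1 := by
    rw [Complex.mul_conj, Complex.normSq_eq_norm_sq, hb1]; simp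
  have key : ∑ i, (u i - b * h i) * starRingEnd ℂ (u i - b * h i) =
      ∑ i, u i * starRingEnd ℂ (u i) - r := by
    calc _ = ∑ i, u i * starRingEnd ℂ (u i) - starRingEnd ℂ b * ∑ i, u i * starRingEnd ℂ (h i) -
          b * ∑ i, h i * starRingEnd ℂ (u i) +
          b * starRingEnd ℂ b * ∑ i, h i * starRingEnd ℂ (h i) := by
          simp only [Finset.mul_sum, ← Finset.sum_sub_distrib, ← Finset.sum_add_distrib]
          exact Finset.sum_congr rfl fun i _ => by rw [map_sub, map_mul]; ring
      _ = _ := by rw [hb', hb2, hh]; linear_combination (-(r : ℂ)) * hbb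
  simp only [Complex.mul_conj, Complex.normSq_eq_norm_sq] at key hf
  have key' : ∑ i, ‖u i - b * h i‖ ^ 2 = ∑ i, ‖u i‖ ^ 2 - r := by exact_mod_cast key
  have hf' : ∑ i, ‖f i‖ ^ 2 = r := by exact_mod_cast hf
  have hle : ∀ i ∈ Finset.univ, ‖u i‖ ^ 2 ≤ ‖f i‖ ^ 2 := fun i _ => by
    simp only [hu]
    split_ifs
    · exact le_rfl
    · simp
  have h0 : ∑ i, ‖u i - b * h i‖ ^ 2 = 0 :=
    le_antisymm (by linarith [Finset.sum_le_sum hle]) (Finset.sum_nonneg fun i _ => by positivity)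
  have hub := (Finset.sum_eq_zero_iff_of_nonneg fun i _ => by positivity).1 h0 i
    (Finset.mem_univ i)
  have huf := (Finset.sum_eq_sum_iff_of_le hle).1 (by linarith) i (Finset.mem_univ i)
  have hub' : u i = b * h i := sub_eq_zero.1 (norm_eq_zero.1 (pow_eq_zero_iff two_ne_zero |>.1 hub))
  by_cases hi : i ∈ A
  · exact ⟨by rw [← hub', hu]; simp [hi], fun h => absurd hi h⟩
  · have hui : u i = 0 := by simp [hu, hi]
    have hfi : f i = 0 := by
      rw [hui] at huf
      simpa using huf.symm
    exact ⟨by rw [← hub', hui, hfi], fun _ => hfi⟩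

end Conjugates

section Transfer

variable {G : Type} [Group G] {π : Set ℕ} {N : Subgroup G}

open Classical in
/-- The class function `g ↦ θ (g_π) χ (g_π')`, supported on the elements with `g_π ∈ N`. -/
def piTransfer (π : Set ℕ) (N : Subgroup G) (θ : N → ℂ) (χ : G → ℂ) (g : G) : ℂ :=
  if h : elemPiPart π g ∈ N then θ ⟨elemPiPart π g, h⟩ * χ (elemPiPart πᶜ g) else 0

variable [Fintype G]

open Classical in
theorem sum_elemPiPart_mem (hN : N ≤ Subgroup.center G) (hNpi : IsPiNumber π (Nat.card N))
    (F : N → G → ℂ) :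
    ∑ g : G, (if h : elemPiPart π g ∈ N then F ⟨elemPiPart π g, h⟩ (elemPiPart πᶜ g) else 0) =
      ∑ n : N, ∑ s : G with IsPiNumber πᶜ (orderOf s), F n s := by
  have hpart : ∀ (n : N) (s : G), IsPiNumber πᶜ (orderOf s) →
      elemPiPart π (n * s) = n ∧ elemPiPart πᶜ (n * s) = s := fun n s hs => by
    have hc : Commute (n : G) s := (Subgroup.mem_center_iff.1 (hN n.2) s).symm
    have hn : IsPiNumber π (orderOf (n : G)) :=
      hNpi.of_dvd (by rw [Subgroup.orderOf_coe]; exact orderOf_dvd_natCard n)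
    exact ⟨elemPiPart_mul_of_commute hc hn hs, elemPiPart_compl_mul_of_commute hc hn hs⟩
  rw [← Finset.sum_product', ← Finset.sum_filter_of_ne
    (p := fun g => elemPiPart π g ∈ N) fun g _ hg => by
      by_contra h
      exact hg (dif_neg h)]
  symm
  refine Finset.sum_nbij (fun p => (p.1 : G) * p.2) (fun p hp => ?_) (fun p hp p' hp' he => ?_)
    (fun g hg => ?_) fun p hp => ?_
  · have h := hpart p.1 p.2 (Finset.mem_filter.1 (Finset.mem_product.1 hp).2).2
    exact Finset.mem_filter.2 ⟨Finset.mem_univ _, by rw [h.1]; exact p.1.2⟩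
  · have h := hpart p.1 p.2 (Finset.mem_filter.1 (Finset.mem_product.1 hp).2).2
    have h' := hpart p'.1 p'.2 (Finset.mem_filter.1 (Finset.mem_product.1 hp').2).2
    dsimp only at he
    rw [he] at h
    exact Prod.ext (Subtype.ext (h.1.symm.trans h'.1)) (h.2.symm.trans h'.2)
  · have h := (Finset.mem_filter.1 (Finset.mem_coe.1 hg)).2
    refine ⟨(⟨_, h⟩, elemPiPart πᶜ g), ?_, elemPiPart_mul_elemPiPart_compl π g⟩
    simpa using isPiNumber_orderOf_elemPiPart πᶜ g
  · have h := hpart p.1 p.2 (Finset.mem_filter.1 (Finset.mem_product.1 hp).2).2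
    have hm : elemPiPart π ((p.1 : G) * p.2) ∈ N := by rw [h.1]; exact p.1.2
    rw [dif_pos hm, h.2]
    congr 1
    exact Subtype.ext h.1.symm

open Classical in
theorem piTransfer_mem_rdzSet (hN : N ≤ Subgroup.center G) (hNpi : IsPiNumber π (Nat.card N))
    (θ μ : N →* ℂ) {χ : G → ℂ} (hχ : χ ∈ rdzSet π G N μ) :
    piTransfer π N θ χ ∈ rdzSet π G N θ ∧ piTransfer π N μ χ = χ := by
  obtain ⟨hirr, hover, m, hm, hmN⟩ := hχ
  obtain ⟨V, _, _, _, ρ, rfl, hρ⟩ := hirr.exists_representation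
  rw [map_one, one_mul] at hm
  have := nontrivial_of_norm_eq_one ρ hρ
  have hGC : (Nat.card G : ℂ) ≠ 0 := by exact_mod_cast Nat.card_pos.ne'
  have hμ := apply_eq_smul_of_charInner_ne_zero hN ρ hρ hover
  have hnorm : ∀ c : N →* ℂ, ∀ n, c n * starRingEnd ℂ (c n) = 1 := fun c n => by
    rw [Complex.mul_conj, Complex.normSq_eq_norm_sq, norm_apply_eq_one]; simp
  have hχ1 : ρ.character 1 ≠ 0 := by
    rw [Representation.char_one]; exact_mod_cast Module.finrank_pos.ne'
  have hone : ∀ (c : N →* ℂ) (χ : G → ℂ) (n : N), piTransfer π N c χ n = c n * χ 1 := by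
    intro c χ n
    have hn : IsPiNumber π (orderOf (n : G)) :=
      hNpi.of_dvd (by rw [Subgroup.orderOf_coe]; exact orderOf_dvd_natCard n)
    have h1 : elemPiPart π (n : G) = n := elemPiPart_of_isPiNumber hn
    have h2 : elemPiPart πᶜ (n : G) = 1 :=
      elemPiPart_of_isPiNumber_compl (by rwa [compl_compl])
    have hmem : elemPiPart π (n : G) ∈ N := by rw [h1]; exact n.2
    rw [piTransfer, dif_pos hmem, h2]
    congr 2
    exact Subtype.ext h1
  have hparts : ∀ g (h : elemPiPart π g ∈ N),
      ρ.character g = μ ⟨_, h⟩ * ρ.character (elemPiPart πᶜ g) := fun g h => by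
    rw [← character_mul_of_apply_eq_smul ρ (hμ ⟨_, h⟩), elemPiPart_mul_elemPiPart_compl]
  have hψ1 : piTransfer π N θ ρ.character 1 = ρ.character 1 := by
    have := hone θ ρ.character 1
    rwa [map_one, one_mul] at this
  obtain ⟨W, _, _, _, τ, hτ0, hτ⟩ := exists_irreducible_of_apply_one_ne_zero (hψ1.trans_ne hχ1)
  obtain ⟨c, hc⟩ := exists_central_character τ hτ N.subtype
    fun a x => (Subgroup.mem_center_iff.1 (hN a.2) x)
  set S := ∑ s : G with IsPiNumber πᶜ (orderOf s), ρ.character s * τ.character s⁻¹ with hS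
  have hψS : ∑ g, piTransfer π N θ ρ.character g * τ.character g⁻¹ =
      (∑ n, θ n * c n⁻¹) * S := by
    have h := sum_elemPiPart_mem hN hNpi
      fun n s => θ n * c n⁻¹ * (ρ.character s * τ.character s⁻¹)
    rw [hS, Finset.sum_mul_sum, ← h]
    refine Finset.sum_congr rfl fun g _ => ?_
    unfold piTransfer
    split_ifs with hg
    · have hg' : g⁻¹ = N.subtype ⟨_, hg⟩⁻¹ * (elemPiPart πᶜ g)⁻¹ := by
        rw [map_inv, ← mul_inv_rev, Subgroup.subtype_apply]
        change _ = (elemPiPart πᶜ g * elemPiPart π g)⁻¹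
        rw [commute_elemPiPart_elemPiPart πᶜ π g, elemPiPart_mul_elemPiPart_compl]
      rw [hg', character_mul_of_apply_eq_smul τ (hc _)]
      ring
    · rw [zero_mul]
  have hθc : ∑ n, θ n * c n⁻¹ = Nat.card N := by
    rcases sum_mul_apply_inv θ c with h | h
    · exact h.1
    · rw [hψS, h, zero_mul] at hτ0
      exact absurd rfl hτ0
  have hInt := isIntegral_index_inv_mul_sum ρ τ hρ hm hmN
  rw [← hS] at hInt
  set b := (N.index : ℂ)⁻¹ * S with hb
  have hcard : (Nat.card G : ℂ) = Nat.card N * N.index := by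
    exact_mod_cast N.card_mul_index.symm
  have hbS : Nat.card G * b = ∑ g, piTransfer π N θ ρ.character g * τ.character g⁻¹ := by
    have hi : (N.index : ℂ) ≠ 0 := by exact_mod_cast Subgroup.index_ne_zero_of_finite
    rw [hψS, hθc, hcard, hb, mul_assoc, mul_inv_cancel_left₀ hi]
  have hb0 : b ≠ 0 := fun h => hτ0 (by rw [← hbS, h, mul_zero])
  let A : Finset G := Finset.univ.filter fun g => elemPiPart π g ∈ N
  let f : G → ℂ := fun g => if g ∈ A then piTransfer π N θ ρ.character g else ρ.character g
  have hfA : ∀ g, ∀ h : elemPiPart π g ∈ N, f g =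
      θ ⟨_, h⟩ * ρ.character (elemPiPart πᶜ g) := fun g h => by
    simp only [f, A, Finset.mem_filter, Finset.mem_univ, true_and, if_pos h, piTransfer, dif_pos h]
  have hfA' : ∀ g, elemPiPart π g ∉ N → f g = ρ.character g := fun g h => by
    simp only [f, A, Finset.mem_filter, Finset.mem_univ, true_and, if_neg h]
  have hfχ : ∀ g, f g * starRingEnd ℂ (f g) = ρ.character g * starRingEnd ℂ (ρ.character g) := by
    intro g
    by_cases h : elemPiPart π g ∈ N
    · rw [hfA g h, hparts g h, map_mul, map_mul]
      linear_combination ρ.character (elemPiPart πᶜ g) *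
        starRingEnd ℂ (ρ.character (elemPiPart πᶜ g)) * (hnorm θ ⟨_, h⟩ - hnorm μ ⟨_, h⟩)
    · rw [hfA' g h]
  have hnorms : ∀ {U : Type} [AddCommGroup U] [Module ℂ U] [FiniteDimensional ℂ U]
      (κ : Representation ℂ G U),
      (Nat.card G : ℂ)⁻¹ * ∑ g : G, κ.character g * κ.character g⁻¹ = 1 →
      ∑ g, κ.character g * starRingEnd ℂ (κ.character g) = Nat.card G := fun κ hκ => by
    simp_rw [conj_character]
    rwa [inv_mul_eq_iff_eq_mul₀ hGC, mul_one] at hκ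
  have hff : ∑ g, f g * starRingEnd ℂ (f g) = Nat.card G := by
    simp_rw [hfχ]; exact hnorms ρ hρ
  have hbA : Nat.card G * b = ∑ g ∈ A, f g * starRingEnd ℂ (τ.character g) := by
    rw [hbS, ← Finset.sum_filter_of_ne (p := fun g => elemPiPart π g ∈ N) fun g _ hg => by
      by_contra h
      exact hg (by rw [piTransfer, dif_neg h, zero_mul])]
    refine Finset.sum_congr rfl fun g hg => ?_
    rw [conj_character, hfA g (Finset.mem_filter.1 hg).2, piTransfer,
      dif_pos (Finset.mem_filter.1 hg).2]
  have hchar : ∀ {U : Type} [AddCommGroup U] [Module ℂ U] [FiniteDimensional ℂ U]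
      (κ : Representation ℂ G U) (g : G), κ.character g ∈ conjSubring (Nat.card G) := fun κ g =>
    trace_mem_conjSubring Nat.card_pos (rep_pow_card κ g)
  have hfmem : ∀ g, f g ∈ conjSubring (Nat.card G) := fun g => by
    by_cases h : elemPiPart π g ∈ N
    · rw [hfA g h]
      refine Subring.mul_mem _ (mem_conjSubring_of_pow_eq_one Nat.card_pos ?_) (hchar ρ _)
      rw [← map_pow, show (⟨_, h⟩ : N) ^ Nat.card G = 1 from Subtype.ext pow_card_eq_one', map_one]
    · rw [hfA' g h]; exact hchar ρ g
  have hb1 := norm_eq_one_of_isIntegral Nat.card_pos Nat.card_pos.ne' hfmem (hchar τ) hff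
    (hnorms τ hτ) hbA hInt hb0
  have heq := eq_mul_of_norm_eq_one hff (hnorms τ hτ) hbA hb1
  have hzero : ∀ g, elemPiPart π g ∉ N → ρ.character g = 0 := fun g h => by
    rw [← hfA' g h]
    exact (heq g).2 fun hA => h (Finset.mem_filter.1 hA).2
  have hfψ : piTransfer π N θ ρ.character = f := funext fun g => by
    by_cases h : elemPiPart π g ∈ N
    · rw [hfA g h, piTransfer, dif_pos h]
    · rw [hfA' g h, hzero g h, piTransfer, dif_neg h]
  have hb_one : b = 1 := by
    have h1 := (heq 1).1
    rw [← hfψ, hψ1, Representation.char_one, Representation.char_one] at h1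
    have h2 := congrArg norm h1
    rw [norm_mul, hb1, one_mul, Complex.norm_natCast, Complex.norm_natCast, Nat.cast_inj] at h2
    have hV : (Module.finrank ℂ V : ℂ) ≠ 0 := by exact_mod_cast Module.finrank_pos.ne'
    rw [← h2] at h1
    exact (mul_eq_right₀ hV).1 h1.symm
  have hψτ : piTransfer π N θ ρ.character = τ.character := by
    rw [hfψ]
    exact funext fun g => by rw [(heq g).1, hb_one, one_mul]
  refine ⟨⟨?_, ?_, m, ?_, hmN⟩, funext fun g => ?_⟩
  · rw [hψτ]
    exact isIrrChar_character τ hτ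
  · refine charInner_ne_zero_of_forall_eq (hψ1.trans_ne hχ1) fun n => ?_
    rw [hone, hψ1]
  · rw [hψ1, hm, map_one, one_mul]
  · by_cases h : elemPiPart π g ∈ N
    · rw [piTransfer, dif_pos h, hparts g h]
    · rw [piTransfer, dif_neg h, hzero g h]

theorem piTransfer_piTransfer (θ κ : N → ℂ) (χ : G → ℂ) (hκ : κ 1 = 1) :
    piTransfer π N θ (piTransfer π N κ χ) = piTransfer π N θ χ := by
  have hpart : ∀ g : G, piTransfer π N κ χ (elemPiPart πᶜ g) = χ (elemPiPart πᶜ g) := fun g => by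
    have hs := isPiNumber_orderOf_elemPiPart πᶜ g
    have h1 := elemPiPart_of_isPiNumber_compl hs
    have hmem : elemPiPart π (elemPiPart πᶜ g) ∈ N := by rw [h1]; exact N.one_mem
    rw [piTransfer, dif_pos hmem, elemPiPart_of_isPiNumber hs,
      show (⟨_, hmem⟩ : N) = 1 from Subtype.ext h1, hκ, one_mul]
  funext g
  rw [piTransfer, hpart, ← piTransfer]

end Transfer

open Classical in
theorem central_relative_defect_zero_bijection
    {G : Type} [Group G] [Finite G] (π : Set ℕ) (N : Subgroup G) [N.Normal]
    (hcent : N ≤ Subgroup.center G) (hNpi : IsPiNumber π (Nat.card ↥N))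
    (θ μ : ↥N → ℂ) (hθ : IsIrrChar ↥N θ) (hμ : IsIrrChar ↥N μ)
    (hinvθ : IsGInvariant N θ) (hinvμ : IsGInvariant N μ) :
    Set.BijOn
      (fun (χ : G → ℂ) (g : G) =>
        if h : elemPiPart π g ∈ N then θ ⟨elemPiPart π g, h⟩ * χ (elemPiPart πᶜ g)
        else 0)
      (rdzSet π G N μ) (rdzSet π G N θ) := by
  have := Fintype.ofFinite G
  have hcomm : ∀ a b : N, Commute a b := fun a b =>
    Subtype.ext (Subgroup.mem_center_iff.1 (hcent b.2) a)
  obtain ⟨θ, rfl⟩ := hθ.exists_monoidHom hcomm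
  obtain ⟨μ, rfl⟩ := hμ.exists_monoidHom hcomm
  refine Set.InvOn.bijOn (f := piTransfer π N θ) (f' := piTransfer π N μ)
    ⟨fun χ hχ => ?_, fun ψ hψ => ?_⟩
    (fun χ hχ => (piTransfer_mem_rdzSet hcent hNpi θ μ hχ).1)
    fun ψ hψ => (piTransfer_mem_rdzSet hcent hNpi μ θ hψ).1
  · rw [piTransfer_piTransfer _ _ _ (map_one θ)]
    exact (piTransfer_mem_rdzSet hcent hNpi θ μ hχ).2
  · rw [piTransfer_piTransfer _ _ _ (map_one μ)]
    exact (piTransfer_mem_rdzSet hcent hNpi μ θ hψ).2
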